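/- First homology of the n × n toric code complex: for every n ≥ 1, the quotient space ker ∂₁ / im ∂₂ of the toric chain complex over 𝔽₂ has dimension 2 over 𝔽₂ (two logical qubits). -/

import Mathlib

/-- The boundary map `∂₂` of the `n × n` toric code complex, from faces
(functions `ZMod n × ZMod n → 𝔽₂`) to edges (functions
`(ZMod n × ZMod n) ⊕ (ZMod n × ZMod n) → 𝔽₂`, the left summand indexing the
horizontal edges `e_h(i,j)` and the right one the vertical edges `e_v(i,j)`).
It sends the indicator of the face `(i,j)` to
`e_h(i,j) + e_h(i,j+1) + e_v(i,j) + e_v(i+1,j)`. -/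
def toricD2 (n : ℕ) :
    ((ZMod n × ZMod n) → ZMod 2) →ₗ[ZMod 2]
      ((ZMod n × ZMod n) ⊕ (ZMod n × ZMod n) → ZMod 2) where
  toFun f := fun e =>
    match e with
    | Sum.inl (i, j) => f (i, j) + f (i, j - 1)
    | Sum.inr (i, j) => f (i, j) + f (i - 1, j)
  map_add' f g := by
    funext e; rcases e with ⟨i, j⟩ | ⟨i, j⟩ <;> simp [Pi.add_apply] <;> ring
  map_smul' c f := by
    funext e; rcases e with ⟨i, j⟩ | ⟨i, j⟩ <;>
      simp [Pi.smul_apply, smul_eq_mul] <;> ring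

/-- The boundary map `∂₁` of the `n × n` toric code complex, from edges to
vertices: it sends `e_h(i,j)` to `v(i,j) + v(i+1,j)` and `e_v(i,j)` to
`v(i,j) + v(i,j+1)`. -/
def toricD1 (n : ℕ) :
    ((ZMod n × ZMod n) ⊕ (ZMod n × ZMod n) → ZMod 2) →ₗ[ZMod 2]
      ((ZMod n × ZMod n) → ZMod 2) where
  toFun g := fun v =>
    g (Sum.inl v) + g (Sum.inl (v.1 - 1, v.2)) + g (Sum.inr v) + g (Sum.inr (v.1, v.2 - 1))
  map_add' f g := by funext v; simp [Pi.add_apply]; ring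
  map_smul' c f := by funext v; simp [Pi.smul_apply, smul_eq_mul]; ring

theorem ZMod.prod_induction {n : ℕ} [NeZero n] {P : ZMod n × ZMod n → Prop} (zero : P (0, 0))
    (step_fst : ∀ i j, P (i, j) → P (i + 1, j)) (step_snd : ∀ i j, P (i, j) → P (i, j + 1))
    (v : ZMod n × ZMod n) : P v := by
  have fst (a : ℕ) : P ((a : ZMod n), 0) := by
    induction a with
    | zero => rwa [Nat.cast_zero]
    | succ a ih => simpa using step_fst _ _ ih
  have snd (a b : ℕ) : P ((a : ZMod n), (b : ZMod n)) := by
    induction b with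
    | zero => simpa using fst a
    | succ b ih => simpa using step_snd _ _ ih
  simpa using snd v.1.val v.2.val

theorem toricD1_comp_toricD2 (n : ℕ) : toricD1 n ∘ₗ toricD2 n = 0 := by
  ext1 v
  ext w
  simp only [toricD1, toricD2, LinearMap.comp_apply, LinearMap.coe_mk, AddHom.coe_mk,
    LinearMap.zero_apply, Pi.zero_apply]
  grind

theorem range_toricD2_le_ker_toricD1 (n : ℕ) :
    LinearMap.range (toricD2 n) ≤ LinearMap.ker (toricD1 n) :=
  LinearMap.range_le_ker_iff.2 (toricD1_comp_toricD2 n)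

theorem ker_toricD2 (n : ℕ) [NeZero n] :
    LinearMap.ker (toricD2 n) = Submodule.span (ZMod 2) {1} := by
  ext f
  rw [LinearMap.mem_ker, Submodule.mem_span_singleton]
  constructor
  · intro hf
    refine ⟨f 0, funext fun v => ?_⟩
    suffices f v = f 0 by simp [this]
    induction v using ZMod.prod_induction with
    | zero => rfl
    | step_fst i j ih =>
      have h := congrFun hf (Sum.inr (i + 1, j))
      simp only [toricD2, LinearMap.coe_mk, AddHom.coe_mk, Pi.zero_apply,
        add_sub_cancel_right] at h
      rw [← ih, CharTwo.add_eq_zero.1 h]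
    | step_snd i j ih =>
      have h := congrFun hf (Sum.inl (i, j + 1))
      simp only [toricD2, LinearMap.coe_mk, AddHom.coe_mk, Pi.zero_apply,
        add_sub_cancel_right] at h
      rw [← ih, CharTwo.add_eq_zero.1 h]
  · rintro ⟨c, rfl⟩
    ext (⟨i, j⟩ | ⟨i, j⟩) <;> simp [toricD2, CharTwo.add_self_eq_zero]

theorem toricD1_single_inl (n : ℕ) (i j : ZMod n) :
    toricD1 n (Pi.single (Sum.inl (i, j)) 1) = Pi.single (i, j) 1 + Pi.single (i + 1, j) 1 := by
  ext ⟨a, b⟩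
  simp [toricD1, Pi.single_apply, sub_eq_iff_eq_add]

theorem toricD1_single_inr (n : ℕ) (i j : ZMod n) :
    toricD1 n (Pi.single (Sum.inr (i, j)) 1) = Pi.single (i, j) 1 + Pi.single (i, j + 1) 1 := by
  ext ⟨a, b⟩
  simp [toricD1, Pi.single_apply, sub_eq_iff_eq_add]

theorem single_sub_single_zero_mem_range_toricD1 (n : ℕ) [NeZero n] (v : ZMod n × ZMod n) :
    (Pi.single v 1 - Pi.single 0 1 : ZMod n × ZMod n → ZMod 2) ∈
      LinearMap.range (toricD1 n) := by
  induction v using ZMod.prod_induction with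
  | zero => exact sub_self (Pi.single 0 1 : ZMod n × ZMod n → ZMod 2) ▸ zero_mem _
  | step_fst i j ih =>
    have h := sub_mem ih (toricD1_single_inl n i j ▸ LinearMap.mem_range_self (toricD1 n) _)
    convert h using 1
    grind
  | step_snd i j ih =>
    have h := sub_mem ih (toricD1_single_inr n i j ▸ LinearMap.mem_range_self (toricD1 n) _)
    convert h using 1
    grind

theorem range_toricD1 (n : ℕ) [NeZero n] :
    LinearMap.range (toricD1 n) =
      LinearMap.ker (∑ v, LinearMap.proj v : (ZMod n × ZMod n → ZMod 2) →ₗ[ZMod 2] ZMod 2) := by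
  apply le_antisymm
  · rintro _ ⟨g, rfl⟩
    have hfst := (Equiv.subRight ((1, 0) : ZMod n × ZMod n)).sum_comp fun v => g (Sum.inl v)
    have hsnd := (Equiv.subRight ((0, 1) : ZMod n × ZMod n)).sum_comp fun v => g (Sum.inr v)
    simp only [Equiv.subRight_apply, Prod.sub_def, sub_zero] at hfst hsnd
    simp [toricD1, Finset.sum_add_distrib, hfst, hsnd, add_assoc, CharTwo.add_self_eq_zero]
  · intro f hf
    have hsum : ∑ v, f v = 0 := by simpa using hf
    have hdecomp : f = ∑ v, f v • (Pi.single v 1 - Pi.single 0 1 : ZMod n × ZMod n → ZMod 2) := by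
      simp only [smul_sub, Finset.sum_sub_distrib, ← Finset.sum_smul, hsum, zero_smul, sub_zero]
      exact pi_eq_sum_univ' f
    rw [hdecomp]
    exact sum_mem fun v _ =>
      Submodule.smul_mem _ _ (single_sub_single_zero_mem_range_toricD1 n v)

theorem finrank_range_toricD2_add_one (n : ℕ) [NeZero n] :
    Module.finrank (ZMod 2) (LinearMap.range (toricD2 n)) + 1 = n * n := by
  have h := LinearMap.finrank_range_add_finrank_ker (toricD2 n)
  rw [ker_toricD2, finrank_span_singleton one_ne_zero] at h
  simpa using h

theorem finrank_range_toricD1_add_one (n : ℕ) [NeZero n] :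
    Module.finrank (ZMod 2) (LinearMap.range (toricD1 n)) + 1 = n * n := by
  have hsurj : Function.Surjective
      (∑ v, LinearMap.proj v : (ZMod n × ZMod n → ZMod 2) →ₗ[ZMod 2] ZMod 2) :=
    fun c => ⟨Pi.single 0 c, by simp⟩
  have h := LinearMap.finrank_range_add_finrank_ker
    (∑ v, LinearMap.proj v : (ZMod n × ZMod n → ZMod 2) →ₗ[ZMod 2] ZMod 2)
  rw [LinearMap.range_eq_top.2 hsurj, finrank_top, ← range_toricD1] at h
  simpa [add_comm] using h

/-- **Statement 15.** First homology of the `n × n` toric code complex: for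
every `n ≥ 1`, `ker ∂₁ / im ∂₂` has dimension `2` over `𝔽₂`
(two logical qubits). -/
theorem toric_first_homology (n : ℕ) (hn : 1 ≤ n) :
    Module.finrank (ZMod 2)
      (↥(LinearMap.ker (toricD1 n)) ⧸
        (LinearMap.range (toricD2 n)).comap (LinearMap.ker (toricD1 n)).subtype) = 2 := by
  have : NeZero n := ⟨Nat.one_le_iff_ne_zero.1 hn⟩
  have hquot := Submodule.finrank_quotient_add_finrank
    ((LinearMap.range (toricD2 n)).comap (LinearMap.ker (toricD1 n)).subtype)
  rw [(Submodule.comapSubtypeEquivOfLe (range_toricD2_le_ker_toricD1 n)).finrank_eq] at hquot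
  have hnullity := LinearMap.finrank_range_add_finrank_ker (toricD1 n)
  simp only [Module.finrank_fintype_fun_eq_card, Fintype.card_sum, Fintype.card_prod,
    ZMod.card] at hnullity
  have hrange1 := finrank_range_toricD1_add_one n
  have hrange2 := finrank_range_toricD2_add_one n
  omega
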